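/- Let Γ be a consistent counter machine with m states, let (y,z) be a Skorokhod solution of the associated problem with z(0) = z^{i⁰,C⁰₁,C⁰₂}, let t ∈ ℕ, and suppose z(5t) = z^{i,C₁,C₂} where (i,C₁,C₂) is the configuration of the trajectory at time t. Let (i′,Δ₁,Δ₂) = Γ(i, 1{C₁>0}, 1{C₂>0}), b* = min(C₁,1), c* = min(C₂,1), and Υ(i″,b,c) = −b−c+(2b−1)·1{C₁=0}+(2c−1)·1{C₂=0}−1{i″=i}. Then on the interval (5t+2, 5t+3): y_{A,3} and y_{E,(i,b*,c*)} are active at unit rate, and all remaining y-coordinates are passive. Moreover z(5t+3) is given by: z_A(5t+3) = (1,1,0,0,1); z_{B,i′}(5t+3) = 0 and z_{B,j}(5t+3) = 1 for j ≠ i′; z_{C,k}(5t+3) = C_k + Δ_k + 1 for k = 1,2; z_D(5t+3) = (0,0); z_{E,(i″,b,c)}(5t+3) = 2 + Υ(i″,b,c) + 1{(i″,b,c) = (i,b*,c*)}; z_{F,(i″,b,c)}(5t+3) = 3 + Υ(i″,b,c) + 1{(i″,b,c) = (i,b*,c*)}. -/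

import Mathlib

open scoped BigOperators

/-- A Skorokhod solution for the matrix `R` and input path `x`:
continuous `y, z` on `[0,∞)` with `z = x + R y`, `z ≥ 0`, `y 0 = 0`,
each `y j` nondecreasing, and `y j` does not increase while `z j > 0`
(the Lebesgue–Stieltjes measure of `y j` vanishes on `{s | z s j > 0}`). -/
def IsSkorokhodSolution {n : Type*} [Fintype n] (R : Matrix n n ℝ)
    (x y z : ℝ → n → ℝ) : Prop :=
  ContinuousOn y (Set.Ici 0) ∧
  ContinuousOn z (Set.Ici 0) ∧
  (∀ t : ℝ, 0 ≤ t → z t = x t + R.mulVec (y t)) ∧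
  (∀ t : ℝ, 0 ≤ t → ∀ j, 0 ≤ z t j) ∧
  (y 0 = 0) ∧
  (∀ j, MonotoneOn (fun t => y t j) (Set.Ici 0)) ∧
  (∀ j, ∀ s₁ s₂ : ℝ, 0 ≤ s₁ → s₁ ≤ s₂ →
      (∀ s ∈ Set.Ioo s₁ s₂, 0 < z s j) → y s₂ j = y s₁ j)

/-- `R` is an S-matrix: some nonnegative `w` with `R w > 0` componentwise. -/
def IsSMatrix {n : Type*} [Fintype n] (R : Matrix n n ℝ) : Prop :=
  ∃ w : n → ℝ, (∀ i, 0 ≤ w i) ∧ (∀ i, 0 < R.mulVec w i)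

/-- `R` is completely-S: every (nonempty) principal submatrix is an S-matrix. -/
def IsCompletelyS {n : Type*} [Fintype n] [DecidableEq n] (R : Matrix n n ℝ) : Prop :=
  ∀ I : Finset n, I.Nonempty →
    IsSMatrix (R.submatrix (fun a : I => (a : n)) (fun a : I => (a : n)))

/-- Stability of the fluid model `(z₀, θ, R)`: every Skorokhod solution for
`x t = z₀ + θ t` satisfies `z t → 0` as `t → ∞`. -/
def FluidStable {n : Type*} [Fintype n] (z0 θv : n → ℝ) (R : Matrix n n ℝ) : Prop :=
  ∀ y z : ℝ → n → ℝ,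
    IsSkorokhodSolution R (fun t i => z0 i + θv i * t) y z →
    Filter.Tendsto z Filter.atTop (nhds 0)

/-- `f` is active at rate `r` on `(s₁, s₂)`. -/
def ActiveAtRate (f : ℝ → ℝ) (r s₁ s₂ : ℝ) : Prop :=
  ∀ s ∈ Set.Ioo s₁ s₂, f s - f s₁ = r * (s - s₁)

/-- `f` is active at unit rate on `(s₁, s₂)`. -/
def UnitActive (f : ℝ → ℝ) (s₁ s₂ : ℝ) : Prop := ActiveAtRate f 1 s₁ s₂

/-- `f` is passive (constant) on `(s₁, s₂)`. -/
def Passive (f : ℝ → ℝ) (s₁ s₂ : ℝ) : Prop := ∀ s ∈ Set.Ioo s₁ s₂, f s = f s₁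

/-- A counter machine with `m` states: update map with moves in
`{(-1,0),(0,-1),(0,0),(1,0),(0,1)}`, never decrementing a zero counter. -/
structure CounterMachine (m : ℕ) where
  Γ : Fin m → Bool → Bool → Fin m × ℤ × ℤ
  moves : ∀ i b c, ((Γ i b c).2.1, (Γ i b c).2.2) ∈
      ({(-1,0), (0,-1), (0,0), (1,0), (0,1)} : Set (ℤ × ℤ))
  consistent : ∀ i b c, (b = false → 0 ≤ (Γ i b c).2.1) ∧ (c = false → 0 ≤ (Γ i b c).2.2)

/-- One step of the counter machine on a configuration. -/
def CounterMachine.step {m : ℕ} (M : CounterMachine m) :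
    Fin m × ℕ × ℕ → Fin m × ℕ × ℕ := fun cfg =>
  let r := M.Γ cfg.1 (decide (0 < cfg.2.1)) (decide (0 < cfg.2.2))
  (r.1, ((cfg.2.1 : ℤ) + r.2.1).toNat, ((cfg.2.2 : ℤ) + r.2.2).toNat)

/-- Index set of the associated Skorokhod problem: groups A (5), B (m), C (2),
D (2), E (4m), F (4m); total dimension 5m + 9. -/
inductive Idx (m : ℕ) where
  | A : Fin 5 → Idx m
  | B : Fin m → Idx m
  | C : Fin 2 → Idx m
  | D : Fin 2 → Idx m
  | E : Fin m → Bool → Bool → Idx m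
  | F : Fin m → Bool → Bool → Idx m
  deriving DecidableEq, Fintype

/-- Numeric value of a bit. -/
def bnum (b : Bool) : ℝ := if b then 1 else 0

/-- Real indicator of a decidable proposition. -/
def indC (P : Prop) [Decidable P] : ℝ := if P then 1 else 0

/-- The 5×5 block AA. -/
def AAmat : Matrix (Fin 5) (Fin 5) ℝ :=
  !![1,2,1,1,0; 0,1,2,1,1; 1,0,1,2,1; 1,1,0,1,2; 2,1,1,0,1]

/-- The reflection matrix `R` associated with the counter machine `M`. -/
def Rmat {m : ℕ} (M : CounterMachine m) : Matrix (Idx m) (Idx m) ℝ :=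
  fun p q => match p, q with
  | .A k, .A l => AAmat k l
  | .B _, .A l => if l = 0 then -1 else 0
  | .B j, .B j' => if j' = j then 1 else 0
  | .B j, .E i b c => if (M.Γ i b c).1 = j then 0 else 1
  | .C _, .A l => if l = 0 ∨ l = 3 then -1 else 0
  | .C k, .C k' => if k' = k then 1 else 0
  | .C k, .D k' => if k' = k then 1 else 0
  | .C k, .E i b c =>
      (if k = 0 then ((M.Γ i b c).2.1 : ℝ) else ((M.Γ i b c).2.2 : ℝ)) + 1
  | .D _, .A l => if l = 1 then -1 else 0
  | .D k, .C k' => if k' = k then 1 else 0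
  | .D k, .D k' => if k' = k then 1 else 0
  | .E _ b c, .A l => if l = 0 then -(bnum b) - bnum c else if l = 2 then -1 else 0
  | .E i _ _, .B j => if j = i then -1 else 0
  | .E _ b c, .C k => if k = 0 then 2 * bnum b - 1 else 2 * bnum c - 1
  | .E i b c, .E i' b' c' => if i' = i ∧ b' = b ∧ c' = c then 1 else 0
  | .E i b c, .F i' b' c' => if i' = i ∧ b' = b ∧ c' = c then 1 else 0
  | .F _ b c, .A l => if l = 0 then -(bnum b) - bnum c
      else if l = 2 then -1 else if l = 3 then -4 else if l = 4 then 4 else 0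
  | .F i _ _, .B j => if j = i then -1 else 0
  | .F _ b c, .C k => if k = 0 then 2 * bnum b - 1 else 2 * bnum c - 1
  | .F i b c, .E i' b' c' => if i' = i ∧ b' = b ∧ c' = c then 1 else 0
  | .F i b c, .F i' b' c' => if i' = i ∧ b' = b ∧ c' = c then 1 else 0
  | _, _ => 0

/-- The modified reflection matrix `R*` with halting state `i*`. -/
def RmatStar {m : ℕ} (M : CounterMachine m) (istar : Fin m) :
    Matrix (Idx m) (Idx m) ℝ :=
  fun p q => match p, q with
  | .A k, .B j => if j = istar ∧ (k = 2 ∨ k = 3 ∨ k = 4) then -1 else 0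
  | .E i b c, .B j =>
      if j = istar then -3 + bnum b + bnum c else if j = i then -1 else 0
  | .F i b c, .B j =>
      if j = istar then -4 + bnum b + bnum c else if j = i then -1 else 0
  | p, q => Rmat M p q

/-- The drift vector θ: −1 on the A-coordinates and 0 elsewhere. -/
def thetaVec (m : ℕ) : Idx m → ℝ := fun p => match p with
  | .A _ => -1
  | _ => 0

/-- The encoding `z^{i,C₁,C₂}` of a configuration as a state of the
Skorokhod problem. -/
def encCfg {m : ℕ} (i : Fin m) (C₁ C₂ : ℕ) : Idx m → ℝ := fun p => match p with
  | .A k => if k = 0 ∨ k = 4 then 0 else 1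
  | .B j => if j = i then 0 else 1
  | .C k => if k = 0 then (C₁ : ℝ) else (C₂ : ℝ)
  | .D _ => 0
  | .E _ _ _ => 3
  | .F _ _ _ => 4

/-- The linear input path `x t = z^{i,C₁,C₂} + θ t`. -/
def fluidX {m : ℕ} (i : Fin m) (C₁ C₂ : ℕ) : ℝ → Idx m → ℝ :=
  fun t p => encCfg i C₁ C₂ p + thetaVec m p * t

/-- The quantity Υ(i′,b,c) of the paper (for current configuration (i,C₁,C₂)). -/
def Upsilon {m : ℕ} (i : Fin m) (C₁ C₂ : ℕ) (i' : Fin m) (b c : Bool) : ℝ :=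
  -(bnum b) - bnum c + (2 * bnum b - 1) * indC (C₁ = 0)
    + (2 * bnum c - 1) * indC (C₂ = 0) - indC (i' = i)

/-- Complementarity facts on the unit time interval. -/
def CompPair (f g : ℝ → ℝ) : Prop :=
  (∀ s ∈ Set.Icc (0:ℝ) 1, 0 ≤ f s) ∧ (∀ s ∈ Set.Icc (0:ℝ) 1, 0 ≤ g s) ∧
  ((∀ s ∈ Set.Icc (0:ℝ) 1, g s = 0 → f s ≤ 0) → ∀ s ∈ Set.Icc (0:ℝ) 1, f s = 0) ∧
  ((∀ s ∈ Set.Icc (0:ℝ) 1, g s = 0 → f s ≤ s) → ∀ s ∈ Set.Icc (0:ℝ) 1, f s ≤ s)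

theorem upper_bound_aux {n : Type*} [Fintype n] {R : Matrix n n ℝ} {x y z : ℝ → n → ℝ}
    (h : IsSkorokhodSolution R x y z) (T : ℝ) (hT : 0 ≤ T) (j : n)
    (c : ℝ → ℝ) (hc : Monotone c) (hc0 : 0 ≤ c 0)
    (H : ∀ s ∈ Set.Icc (0:ℝ) 1, z (T + s) j = 0 → y (T + s) j - y T j ≤ c s) :
    ∀ s ∈ Set.Icc (0:ℝ) 1, y (T + s) j - y T j ≤ c s := by
  obtain ⟨-, hzc, -, hz0, -, -, hcomp⟩ := h
  intro s hs
  have hcont : ContinuousOn (fun u => z (T + u) j) (Set.Icc 0 s) := by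
    have h1 : ContinuousOn (fun u => z u j) (Set.Ici 0) := (continuous_apply j).comp_continuousOn hzc
    refine h1.comp (by fun_prop) ?_
    intro u hu
    have := hu.1
    show (0:ℝ) ≤ T + u
    linarith
  set K : Set ℝ := Set.Icc 0 s ∩ (fun u => z (T + u) j) ⁻¹' {0} with hK
  have hKcl : IsClosed K := hcont.preimage_isClosed_of_isClosed isClosed_Icc isClosed_singleton
  have hKcpt : IsCompact K := isCompact_Icc.of_isClosed_subset hKcl Set.inter_subset_left
  by_cases hne : K.Nonempty
  · obtain ⟨u, hu, hmax⟩ := hKcpt.exists_isGreatest hne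
    have hus : u ≤ s := hu.1.2
    have hu0 : 0 ≤ u := hu.1.1
    have e : y (T + s) j = y (T + u) j := by
      apply hcomp j _ _ (by linarith) (by linarith)
      intro v hv
      have hv0 : 0 ≤ v := by linarith [hv.1]
      refine lt_of_le_of_ne (hz0 v hv0 j) ?_
      intro hzv
      have : v - T ∈ K := by
        refine ⟨⟨by linarith [hv.1], by linarith [hv.2]⟩, ?_⟩
        simp [← hzv]
      have := hmax this
      linarith [hv.1]
    rw [e]
    exact (H u ⟨hu0, hus.trans hs.2⟩ hu.2).trans (hc hus)
  · have e : y (T + s) j = y T j := by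
      apply hcomp j _ _ hT (by linarith [hs.1])
      intro v hv
      have hv0 : 0 ≤ v := by linarith [hv.1]
      refine lt_of_le_of_ne (hz0 v hv0 j) ?_
      intro hzv
      apply hne
      refine ⟨v - T, ⟨by linarith [hv.1], by linarith [hv.2]⟩, ?_⟩
      simp [← hzv]
    rw [e, sub_self]
    exact hc0.trans (hc hs.1)

theorem compPair_of {n : Type*} [Fintype n] {R : Matrix n n ℝ} {x y z : ℝ → n → ℝ}
    (h : IsSkorokhodSolution R x y z) (T : ℝ) (hT : 0 ≤ T) (j : n) :
    CompPair (fun s => y (T + s) j - y T j) (fun s => z (T + s) j) := by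
  have hnn : ∀ s ∈ Set.Icc (0:ℝ) 1, 0 ≤ y (T + s) j - y T j := by
    intro s hs
    have := h.2.2.2.2.2.1 j (show T ∈ Set.Ici (0:ℝ) from hT)
      (show T + s ∈ Set.Ici (0:ℝ) from add_nonneg hT hs.1) (by linarith [hs.1])
    simpa using this
  refine ⟨hnn, ?_, ?_, ?_⟩
  · intro s hs
    exact h.2.2.2.1 _ (add_nonneg hT hs.1) j
  · intro H s hs
    exact le_antisymm (upper_bound_aux h T hT j (fun _ => 0) monotone_const le_rfl H s hs) (hnn s hs)
  · intro H s hs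
    exact upper_bound_aux h T hT j (fun s => s) monotone_id le_rfl H s hs

/-- The index type as a sum type. -/
def idxEquiv (m : ℕ) : Idx m ≃
    (Fin 5 ⊕ Fin m ⊕ Fin 2 ⊕ Fin 2 ⊕ (Fin m × Bool × Bool) ⊕ (Fin m × Bool × Bool)) where
  toFun p := match p with
    | .A k => .inl k
    | .B k => .inr (.inl k)
    | .C k => .inr (.inr (.inl k))
    | .D k => .inr (.inr (.inr (.inl k)))
    | .E i b c => .inr (.inr (.inr (.inr (.inl (i, b, c)))))
    | .F i b c => .inr (.inr (.inr (.inr (.inr (i, b, c)))))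
  invFun p := match p with
    | .inl k => .A k
    | .inr (.inl k) => .B k
    | .inr (.inr (.inl k)) => .C k
    | .inr (.inr (.inr (.inl k))) => .D k
    | .inr (.inr (.inr (.inr (.inl (i, b, c))))) => .E i b c
    | .inr (.inr (.inr (.inr (.inr (i, b, c))))) => .F i b c
  left_inv p := by cases p <;> rfl
  right_inv p := by rcases p with k | k | k | k | ⟨i, b, c⟩ | ⟨i, b, c⟩ <;> rfl

theorem idx_sum {m : ℕ} (f : Idx m → ℝ) :
    ∑ p, f p = (∑ k, f (.A k)) + ((∑ k, f (.B k)) + ((∑ k, f (.C k)) + ((∑ k, f (.D k)) +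
      ((∑ e : Fin m × Bool × Bool, f (.E e.1 e.2.1 e.2.2)) +
        (∑ e : Fin m × Bool × Bool, f (.F e.1 e.2.1 e.2.2)))))) := by
  rw [← Equiv.sum_comp (idxEquiv m).symm f]
  simp only [Fintype.sum_sum_type]
  rfl

theorem sum_delta {m : ℕ} (i : Fin m) (b c : Bool) (g : Fin m → Bool → Bool → ℝ) :
    ∑ e : Fin m × Bool × Bool,
      (if e.1 = i ∧ e.2.1 = b ∧ e.2.2 = c then (1:ℝ) else 0) * g e.1 e.2.1 e.2.2 = g i b c := by
  rw [Finset.sum_eq_single (i, b, c)]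
  · simp
  · rintro ⟨i1, b1, c1⟩ - hne
    have : ¬ (i1 = i ∧ b1 = b ∧ c1 = c) := by
      rintro ⟨rfl, rfl, rfl⟩
      exact hne rfl
    simp [this]
  · simp

section rows
variable {m : ℕ} (M : CounterMachine m) (w : Idx m → ℝ)

theorem row_A0 : (Rmat M).mulVec w (.A 0) =
    w (.A 0) + 2 * w (.A 1) + w (.A 2) + w (.A 3) := by
  simp [Matrix.mulVec, dotProduct, idx_sum, Rmat, AAmat, Fin.sum_univ_succ]; ring
theorem row_A1 : (Rmat M).mulVec w (.A 1) =
    w (.A 1) + 2 * w (.A 2) + w (.A 3) + w (.A 4) := by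
  simp [Matrix.mulVec, dotProduct, idx_sum, Rmat, AAmat, Fin.sum_univ_succ]; ring_nf
theorem row_A2 : (Rmat M).mulVec w (.A 2) =
    w (.A 2) + 2 * w (.A 3) + w (.A 4) + w (.A 0) := by
  simp [Matrix.mulVec, dotProduct, idx_sum, Rmat, AAmat, Fin.sum_univ_succ]; ring_nf
theorem row_A3 : (Rmat M).mulVec w (.A 3) =
    w (.A 3) + 2 * w (.A 4) + w (.A 0) + w (.A 1) := by
  simp [Matrix.mulVec, dotProduct, idx_sum, Rmat, AAmat, Fin.sum_univ_succ]; ring_nf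
theorem row_A4 : (Rmat M).mulVec w (.A 4) =
    w (.A 4) + 2 * w (.A 0) + w (.A 1) + w (.A 2) := by
  simp [Matrix.mulVec, dotProduct, idx_sum, Rmat, AAmat, Fin.sum_univ_succ]; ring_nf

theorem row_B (j : Fin m) : (Rmat M).mulVec w (.B j) =
    - w (.A 0) + w (.B j) + ∑ e : Fin m × Bool × Bool,
      (if (M.Γ e.1 e.2.1 e.2.2).1 = j then 0 else 1) * w (.E e.1 e.2.1 e.2.2) := by
  simp only [Matrix.mulVec, dotProduct, idx_sum, Rmat]
  simp
  ring

theorem row_C (k : Fin 2) : (Rmat M).mulVec w (.C k) =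
    - w (.A 0) - w (.A 3) + w (.C k) + w (.D k) + ∑ e : Fin m × Bool × Bool,
      ((if k = 0 then ((M.Γ e.1 e.2.1 e.2.2).2.1 : ℝ) else ((M.Γ e.1 e.2.1 e.2.2).2.2 : ℝ)) + 1)
        * w (.E e.1 e.2.1 e.2.2) := by
  simp only [Matrix.mulVec, dotProduct, idx_sum, Rmat]
  simp [Fin.sum_univ_five]
  ring

theorem row_D (k : Fin 2) : (Rmat M).mulVec w (.D k) =
    - w (.A 1) + w (.C k) + w (.D k) := by
  simp only [Matrix.mulVec, dotProduct, idx_sum, Rmat]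
  simp
  ring

theorem row_E (i : Fin m) (b c : Bool) : (Rmat M).mulVec w (.E i b c) =
    (-(bnum b) - bnum c) * w (.A 0) - w (.A 2) - w (.B i)
      + (2 * bnum b - 1) * w (.C 0) + (2 * bnum c - 1) * w (.C 1)
      + w (.E i b c) + w (.F i b c) := by
  simp only [Matrix.mulVec, dotProduct, idx_sum, Rmat]
  rw [sum_delta i b c (fun i b c => w (.E i b c)), sum_delta i b c (fun i b c => w (.F i b c))]
  simp [Fin.sum_univ_five]
  ring

theorem row_F (i : Fin m) (b c : Bool) : (Rmat M).mulVec w (.F i b c) =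
    (-(bnum b) - bnum c) * w (.A 0) - w (.A 2) - 4 * w (.A 3) + 4 * w (.A 4) - w (.B i)
      + (2 * bnum b - 1) * w (.C 0) + (2 * bnum c - 1) * w (.C 1)
      + w (.E i b c) + w (.F i b c) := by
  simp only [Matrix.mulVec, dotProduct, idx_sum, Rmat]
  rw [sum_delta i b c (fun i b c => w (.E i b c)), sum_delta i b c (fun i b c => w (.F i b c))]
  simp [Fin.sum_univ_five]
  ring

theorem sumB_nonneg (hw : ∀ i b c, 0 ≤ w (.E i b c)) (j : Fin m) :
    0 ≤ ∑ e : Fin m × Bool × Bool,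
      (if (M.Γ e.1 e.2.1 e.2.2).1 = j then (0:ℝ) else 1) * w (.E e.1 e.2.1 e.2.2) := by
  apply Finset.sum_nonneg
  intro e _
  apply mul_nonneg _ (hw _ _ _)
  split_ifs <;> norm_num

theorem move_ge (i : Fin m) (b c : Bool) : -1 ≤ (M.Γ i b c).2.1 ∧ -1 ≤ (M.Γ i b c).2.2 := by
  have := M.moves i b c
  simp only [Set.mem_insert_iff, Set.mem_singleton_iff, Prod.mk.injEq] at this
  omega

theorem sumC_nonneg (hw : ∀ i b c, 0 ≤ w (.E i b c)) (k : Fin 2) :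
    0 ≤ ∑ e : Fin m × Bool × Bool,
      ((if k = 0 then ((M.Γ e.1 e.2.1 e.2.2).2.1 : ℝ) else ((M.Γ e.1 e.2.1 e.2.2).2.2 : ℝ)) + 1)
        * w (.E e.1 e.2.1 e.2.2) := by
  apply Finset.sum_nonneg
  intro e _
  apply mul_nonneg _ (hw _ _ _)
  have h := move_ge M e.1 e.2.1 e.2.2
  have h1 : (-1:ℝ) ≤ ((M.Γ e.1 e.2.1 e.2.2).2.1 : ℝ) := by exact_mod_cast h.1
  have h2 : (-1:ℝ) ≤ ((M.Γ e.1 e.2.1 e.2.2).2.2 : ℝ) := by exact_mod_cast h.2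
  split_ifs <;> linarith

end rows

/-- One cyclic step of the A block. -/
theorem A_cycle {w0 w1 w2 w3 w4 z0 z1 z2 z3 z4 : ℝ → ℝ}
    (c0 : CompPair w0 z0) (c1 : CompPair w1 z1) (c2 : CompPair w2 z2)
    (c3 : CompPair w3 z3) (c4 : CompPair w4 z4)
    (e0 : ∀ s ∈ Set.Icc (0:ℝ) 1, z0 s = 0 - s + (w0 s + 2 * w1 s + w2 s + w3 s))
    (e1 : ∀ s ∈ Set.Icc (0:ℝ) 1, z1 s = 1 - s + (w1 s + 2 * w2 s + w3 s + w4 s))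
    (e2 : ∀ s ∈ Set.Icc (0:ℝ) 1, z2 s = 1 - s + (w2 s + 2 * w3 s + w4 s + w0 s))
    (e3 : ∀ s ∈ Set.Icc (0:ℝ) 1, z3 s = 1 - s + (w3 s + 2 * w4 s + w0 s + w1 s))
    (e4 : ∀ s ∈ Set.Icc (0:ℝ) 1, z4 s = 0 - s + (w4 s + 2 * w0 s + w1 s + w2 s)) :
    ∀ s ∈ Set.Icc (0:ℝ) 1, w0 s = s ∧ w1 s = 0 ∧ w2 s = 0 ∧ w3 s = 0 ∧ w4 s = 0 := by
  have f1 := c1.2.2.1 (fun s hs hz => by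
    linarith [e1 s hs, c0.1 s hs, c1.1 s hs, c2.1 s hs, c3.1 s hs, c4.1 s hs, hs.2])
  have f2 := c2.2.2.1 (fun s hs hz => by
    linarith [e2 s hs, c0.1 s hs, c1.1 s hs, c2.1 s hs, c3.1 s hs, c4.1 s hs, hs.2])
  have f3 := c3.2.2.1 (fun s hs hz => by
    linarith [e3 s hs, c0.1 s hs, c1.1 s hs, c2.1 s hs, c3.1 s hs, c4.1 s hs, hs.2])
  have f4 := c4.2.2.1 (fun s hs hz => by
    linarith [e4 s hs, e0 s hs, c0.2.1 s hs, f1 s hs, f2 s hs, f3 s hs, hs.1])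
  have f0 := c0.2.2.2 (fun s hs hz => by
    linarith [e0 s hs, f1 s hs, f2 s hs, f3 s hs])
  intro s hs
  refine ⟨le_antisymm (f0 s hs) ?_, f1 s hs, f2 s hs, f3 s hs, f4 s hs⟩
  linarith [e0 s hs, c0.2.1 s hs, f1 s hs, f2 s hs, f3 s hs]

theorem z_local {m : ℕ} {M : CounterMachine m} {i0 : Fin m} {C₁0 C₂0 : ℕ}
    {y z : ℝ → Idx m → ℝ} (h : IsSkorokhodSolution (Rmat M) (fluidX i0 C₁0 C₂0) y z)
    (T : ℝ) (hT : 0 ≤ T) (p : Idx m) : ∀ s ∈ Set.Icc (0:ℝ) 1,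
    z (T + s) p = z T p + thetaVec m p * s
      + (Rmat M).mulVec (fun q => y (T + s) q - y T q) p := by
  intro s hs
  have e1 := congrFun (h.2.2.1 T hT) p
  have e2 := congrFun (h.2.2.1 (T + s) (add_nonneg hT hs.1)) p
  have e3 : (fun q => y (T + s) q - y T q) = y (T + s) - y T := rfl
  rw [e3, Matrix.mulVec_sub, e1, e2]
  simp only [fluidX, Pi.add_apply, Pi.sub_apply]
  ring

theorem ups_bounds {m : ℕ} (i : Fin m) (C₁ C₂ : ℕ) (i'' : Fin m) (b c : Bool) :
    -3 ≤ Upsilon i C₁ C₂ i'' b c ∧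
    ((i'', b, c) ≠ (i, decide (0 < C₁), decide (0 < C₂)) → -2 ≤ Upsilon i C₁ C₂ i'' b c) ∧
    ((i'', b, c) = (i, decide (0 < C₁), decide (0 < C₂)) → Upsilon i C₁ C₂ i'' b c = -3) := by
  rcases C₁ with _ | n₁ <;> rcases C₂ with _ | n₂ <;>
  by_cases hi : i'' = i <;> cases b <;> cases c <;>
  simp [Upsilon, indC, bnum, hi] <;> norm_num

/-- counter value by index -/
def cval (C₁ C₂ : ℕ) (k : Fin 2) : ℕ := if k = 0 then C₁ else C₂

/-- The E-contribution to row B. -/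
noncomputable def SB {m : ℕ} (M : CounterMachine m) (w : Idx m → ℝ) (j : Fin m) : ℝ :=
  ∑ e : Fin m × Bool × Bool,
    (if (M.Γ e.1 e.2.1 e.2.2).1 = j then 0 else 1) * w (.E e.1 e.2.1 e.2.2)

/-- The E-contribution to row C. -/
noncomputable def SC {m : ℕ} (M : CounterMachine m) (w : Idx m → ℝ) (k : Fin 2) : ℝ :=
  ∑ e : Fin m × Bool × Bool,
    ((if k = 0 then ((M.Γ e.1 e.2.1 e.2.2).2.1 : ℝ) else ((M.Γ e.1 e.2.1 e.2.2).2.2 : ℝ)) + 1)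
      * w (.E e.1 e.2.1 e.2.2)

theorem SB_zero {m : ℕ} (M : CounterMachine m) (w : Idx m → ℝ) (j : Fin m)
    (hw : ∀ i b c, w (.E i b c) = 0) : SB M w j = 0 := by
  simp [SB, hw]

theorem SC_zero {m : ℕ} (M : CounterMachine m) (w : Idx m → ℝ) (k : Fin 2)
    (hw : ∀ i b c, w (.E i b c) = 0) : SC M w k = 0 := by
  simp [SC, hw]

/-- The local system on `[T, T+1]`, in terms of the increments `w` of `y`. -/
structure LocalSys {m : ℕ} (M : CounterMachine m) (T : ℝ) (y z w : ℝ → Idx m → ℝ) : Prop where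
  inc : ∀ s q, y (T + s) q = y T q + w s q
  comp : ∀ p, CompPair (fun s => w s p) (fun s => z (T + s) p)
  sb : ∀ j, ∀ s ∈ Set.Icc (0:ℝ) 1, 0 ≤ SB M (w s) j
  sc : ∀ k, ∀ s ∈ Set.Icc (0:ℝ) 1, 0 ≤ SC M (w s) k
  a0 : ∀ s ∈ Set.Icc (0:ℝ) 1, z (T + s) (.A 0) = z T (.A 0) - s
    + (w s (.A 0) + 2 * w s (.A 1) + w s (.A 2) + w s (.A 3))
  a1 : ∀ s ∈ Set.Icc (0:ℝ) 1, z (T + s) (.A 1) = z T (.A 1) - s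
    + (w s (.A 1) + 2 * w s (.A 2) + w s (.A 3) + w s (.A 4))
  a2 : ∀ s ∈ Set.Icc (0:ℝ) 1, z (T + s) (.A 2) = z T (.A 2) - s
    + (w s (.A 2) + 2 * w s (.A 3) + w s (.A 4) + w s (.A 0))
  a3 : ∀ s ∈ Set.Icc (0:ℝ) 1, z (T + s) (.A 3) = z T (.A 3) - s
    + (w s (.A 3) + 2 * w s (.A 4) + w s (.A 0) + w s (.A 1))
  a4 : ∀ s ∈ Set.Icc (0:ℝ) 1, z (T + s) (.A 4) = z T (.A 4) - s
    + (w s (.A 4) + 2 * w s (.A 0) + w s (.A 1) + w s (.A 2))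
  rB : ∀ j, ∀ s ∈ Set.Icc (0:ℝ) 1, z (T + s) (.B j) = z T (.B j) - w s (.A 0) + w s (.B j)
    + SB M (w s) j
  rC : ∀ k, ∀ s ∈ Set.Icc (0:ℝ) 1, z (T + s) (.C k) = z T (.C k) - w s (.A 0) - w s (.A 3)
    + w s (.C k) + w s (.D k) + SC M (w s) k
  rD : ∀ k, ∀ s ∈ Set.Icc (0:ℝ) 1, z (T + s) (.D k) = z T (.D k) - w s (.A 1)
    + w s (.C k) + w s (.D k)
  rE : ∀ i b c, ∀ s ∈ Set.Icc (0:ℝ) 1, z (T + s) (.E i b c) = z T (.E i b c)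
    + (-(bnum b) - bnum c) * w s (.A 0) - w s (.A 2) - w s (.B i)
    + (2 * bnum b - 1) * w s (.C 0) + (2 * bnum c - 1) * w s (.C 1)
    + w s (.E i b c) + w s (.F i b c)
  rF : ∀ i b c, ∀ s ∈ Set.Icc (0:ℝ) 1, z (T + s) (.F i b c) = z T (.F i b c)
    + (-(bnum b) - bnum c) * w s (.A 0) - w s (.A 2) - 4 * w s (.A 3) + 4 * w s (.A 4)
    - w s (.B i) + (2 * bnum b - 1) * w s (.C 0) + (2 * bnum c - 1) * w s (.C 1)
    + w s (.E i b c) + w s (.F i b c)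

theorem exists_localSys {m : ℕ} {M : CounterMachine m} {i0 : Fin m} {C₁0 C₂0 : ℕ}
    {y z : ℝ → Idx m → ℝ} (h : IsSkorokhodSolution (Rmat M) (fluidX i0 C₁0 C₂0) y z)
    (T : ℝ) (hT : 0 ≤ T) : ∃ w, LocalSys M T y z w := by
  have hP := compPair_of h T hT
  have hL := z_local h T hT
  refine ⟨fun s q => y (T + s) q - y T q, ?_⟩
  constructor
  · intro s q; ring
  · exact hP
  · intro j s hs
    exact sumB_nonneg M (fun q => y (T + s) q - y T q) (fun i b c => (hP (.E i b c)).1 s hs) j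
  · intro j s hs
    exact sumC_nonneg M (fun q => y (T + s) q - y T q) (fun i b c => (hP (.E i b c)).1 s hs) j
  · intro s hs; rw [hL _ s hs, row_A0]; simp only [thetaVec]; ring
  · intro s hs; rw [hL _ s hs, row_A1]; simp only [thetaVec]; ring
  · intro s hs; rw [hL _ s hs, row_A2]; simp only [thetaVec]; ring
  · intro s hs; rw [hL _ s hs, row_A3]; simp only [thetaVec]; ring
  · intro s hs; rw [hL _ s hs, row_A4]; simp only [thetaVec]; ring
  · intro j s hs; rw [hL _ s hs, row_B]; simp only [thetaVec, SB]; ring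
  · intro j s hs; rw [hL _ s hs, row_C]; simp only [thetaVec, SC]; ring
  · intro j s hs; rw [hL _ s hs, row_D]; simp only [thetaVec]; ring
  · intro i b c s hs; rw [hL _ s hs, row_E]; simp only [thetaVec]; ring
  · intro i b c s hs; rw [hL _ s hs, row_F]; simp only [thetaVec]; ring

theorem phase_one {m : ℕ} {M : CounterMachine m} {T : ℝ}
    {y z w : ℝ → Idx m → ℝ} (L : LocalSys M T y z w)
    (i : Fin m) (C₁ C₂ : ℕ) (hz : z T = encCfg i C₁ C₂) :
    z (T + 1) (.A 0) = 0 ∧ z (T + 1) (.A 1) = 0 ∧ z (T + 1) (.A 2) = 1 ∧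
    z (T + 1) (.A 3) = 1 ∧ z (T + 1) (.A 4) = 1 ∧
    (∀ j, z (T + 1) (.B j) = 0) ∧
    (∀ k, z (T + 1) (.C k) = cval C₁ C₂ k - 1 + indC (cval C₁ C₂ k = 0)) ∧
    (∀ k, z (T + 1) (.D k) = indC (cval C₁ C₂ k = 0)) ∧
    (∀ i'' b c, z (T + 1) (.E i'' b c) = 3 + Upsilon i C₁ C₂ i'' b c) ∧
    (∀ i'' b c, z (T + 1) (.F i'' b c) = 4 + Upsilon i C₁ C₂ i'' b c) := by
  have zA0 : z T (.A 0) = 0 := by rw [hz]; simp [encCfg]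
  have zA1 : z T (.A 1) = 1 := by rw [hz]; simp [encCfg]
  have zA2 : z T (.A 2) = 1 := by rw [hz]; simp [encCfg]
  have zA3 : z T (.A 3) = 1 := by rw [hz]; simp [encCfg]
  have zA4 : z T (.A 4) = 0 := by rw [hz]; simp [encCfg]
  have zB : ∀ j, z T (.B j) = 1 - indC (j = i) := by
    intro j; rw [hz]; by_cases hj : j = i <;> simp [encCfg, indC, hj]
  have zC : ∀ k, z T (.C k) = cval C₁ C₂ k := by
    intro k; rw [hz]; by_cases hj : k = 0 <;> simp [encCfg, cval, hj]
  have zD : ∀ k, z T (.D k) = 0 := by intro k; rw [hz]; simp [encCfg]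
  have zE : ∀ i b c, z T (.E i b c) = 3 := by intro _ _ _; rw [hz]; simp [encCfg]
  have zF : ∀ i b c, z T (.F i b c) = 4 := by intro _ _ _; rw [hz]; simp [encCfg]
  have hA := A_cycle (L.comp (.A 0)) (L.comp (.A 1)) (L.comp (.A 2)) (L.comp (.A 3))
    (L.comp (.A 4))
    (by simpa [zA0] using L.a0) (by simpa [zA1] using L.a1) (by simpa [zA2] using L.a2)
    (by simpa [zA3] using L.a3) (by simpa [zA4] using L.a4)
  have ind01 : ∀ j, (indC (j = i) = 0 ∨ indC (j = i) = 1) := by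
    intro j; by_cases hj : j = i <;> simp [indC, hj]
  have nn := fun p => (L.comp p).1
  -- B upper bounds
  have hBle : ∀ j, ∀ s ∈ Set.Icc (0:ℝ) 1, w s (.B j) ≤ indC (j = i) * s := by
    intro j
    rcases ind01 j with hj | hj
    · have := (L.comp (.B j)).2.2.1 (fun s hs h0 => by
        have e := L.rB j s hs
        have := L.sb j s hs
        rw [zB, hj, (hA s hs).1] at e
        linarith [hs.2])
      intro s hs
      rw [hj, zero_mul]
      exact (this s hs).le
    · have := (L.comp (.B j)).2.2.2 (fun s hs h0 => by
        have e := L.rB j s hs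
        have := L.sb j s hs
        rw [zB, hj, (hA s hs).1] at e
        linarith [hs.2])
      intro s hs
      rw [hj, one_mul]
      exact this s hs
  have hC0 : ∀ k, ((cval C₁ C₂ k : ℝ) = 0 ∧ indC (cval C₁ C₂ k = 0) = 1) ∨
      ((1:ℝ) ≤ cval C₁ C₂ k ∧ indC (cval C₁ C₂ k = 0) = 0) := by
    intro k
    rcases Nat.eq_zero_or_pos (cval C₁ C₂ k) with hk | hk
    · left; simp [indC, hk]
    · right
      refine ⟨by exact_mod_cast hk, ?_⟩
      simp [indC, Nat.pos_iff_ne_zero.mp hk]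
  have hCle : ∀ k, ∀ s ∈ Set.Icc (0:ℝ) 1, w s (.C k) ≤ indC (cval C₁ C₂ k = 0) * s := by
    intro k
    rcases hC0 k with ⟨hk, hj⟩ | ⟨hk, hj⟩
    · have := (L.comp (.C k)).2.2.2 (fun s hs h0 => by
        have e := L.rC k s hs
        have := L.sc k s hs
        have := nn (.D k) s hs
        rw [zC, hk, (hA s hs).1, (hA s hs).2.2.2.1] at e
        linarith [hs.2])
      intro s hs
      rw [hj, one_mul]
      exact this s hs
    · have := (L.comp (.C k)).2.2.1 (fun s hs h0 => by
        have e := L.rC k s hs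
        have := L.sc k s hs
        have := nn (.D k) s hs
        rw [zC, (hA s hs).1, (hA s hs).2.2.2.1] at e
        linarith [hs.2])
      intro s hs
      rw [hj, zero_mul]
      exact (this s hs).le
  have hD0 : ∀ k, ∀ s ∈ Set.Icc (0:ℝ) 1, w s (.D k) = 0 := by
    intro k
    refine (L.comp (.D k)).2.2.1 (fun s hs h0 => ?_)
    have e := L.rD k s hs
    have := nn (.C k) s hs
    rw [zD, (hA s hs).2.1] at e
    linarith
  have base : ∀ i'' b c, ∀ s ∈ Set.Icc (0:ℝ) 1,
      -3 * s ≤ (-(bnum b) - bnum c) * s - w s (.B i'')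
        + (2 * bnum b - 1) * w s (.C 0) + (2 * bnum c - 1) * w s (.C 1) := by
    intro i'' b c s hs
    have b1 : w s (.B i'') ≤ s := by
      have := hBle i'' s hs
      rcases ind01 i'' with hj | hj <;> rw [hj] at this <;> linarith [hs.1]
    have b2 : ∀ k, w s (.C k) ≤ s := by
      intro k
      have := hCle k s hs
      rcases hC0 k with ⟨hk, hj⟩ | ⟨hk, hj⟩ <;> rw [hj] at this <;> linarith [hs.1]
    have c0 := b2 0
    have c1 := b2 1
    have d0 := nn (.C 0) s hs
    have d1 := nn (.C 1) s hs
    have := hs.1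
    cases b <;> cases c <;> simp only [bnum] <;> norm_num <;> linarith
  have hE0 : ∀ i'' b c, ∀ s ∈ Set.Icc (0:ℝ) 1, w s (.E i'' b c) = 0 := by
    intro i'' b c
    refine (L.comp (.E i'' b c)).2.2.1 (fun s hs h0 => ?_)
    have e := L.rE i'' b c s hs
    have := base i'' b c s hs
    have := nn (.F i'' b c) s hs
    rw [zE, (hA s hs).1, (hA s hs).2.2.1] at e
    linarith [hs.2]
  have hF0 : ∀ i'' b c, ∀ s ∈ Set.Icc (0:ℝ) 1, w s (.F i'' b c) = 0 := by
    intro i'' b c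
    refine (L.comp (.F i'' b c)).2.2.1 (fun s hs h0 => ?_)
    have e := L.rF i'' b c s hs
    have := base i'' b c s hs
    have := nn (.E i'' b c) s hs
    rw [zF, (hA s hs).1, (hA s hs).2.2.1, (hA s hs).2.2.2.1, (hA s hs).2.2.2.2] at e
    linarith [hs.2]
  have h1 : (1:ℝ) ∈ Set.Icc (0:ℝ) 1 := by simp
  obtain ⟨q0, q1, q2, q3, q4⟩ := hA 1 h1
  have sb0 : ∀ j, SB M (w 1) j = 0 := fun j => SB_zero M _ j (fun i b c => hE0 i b c 1 h1)
  have sc0 : ∀ j, SC M (w 1) j = 0 := fun j => SC_zero M _ j (fun i b c => hE0 i b c 1 h1)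
  have wB : ∀ j, w 1 (.B j) = indC (j = i) := by
    intro j
    have e := L.rB j 1 h1
    have p := (L.comp (.B j)).2.1 1 h1
    have u := hBle j 1 h1
    rw [zB, q0, sb0] at e
    linarith
  have wC : ∀ k, w 1 (.C k) = indC (cval C₁ C₂ k = 0) := by
    intro k
    have e := L.rC k 1 h1
    have p := (L.comp (.C k)).2.1 1 h1
    have u := hCle k 1 h1
    have n := nn (.C k) 1 h1
    rw [zC, q0, q3, sc0, hD0 k 1 h1] at e
    rcases hC0 k with ⟨hk, hj⟩ | ⟨hk, hj⟩ <;> rw [hj] at u ⊢ <;> linarith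
  have cv0 : cval C₁ C₂ 0 = C₁ := by simp [cval]
  have cv1 : cval C₁ C₂ 1 = C₂ := by simp [cval]
  refine ⟨?_, ?_, ?_, ?_, ?_, ?_, ?_, ?_, ?_, ?_⟩
  · rw [L.a0 1 h1, zA0, q0, q1, q2, q3]; norm_num
  · rw [L.a1 1 h1, zA1, q1, q2, q3, q4]; norm_num
  · rw [L.a2 1 h1, zA2, q0, q2, q3, q4]; norm_num
  · rw [L.a3 1 h1, zA3, q0, q1, q3, q4]; norm_num
  · rw [L.a4 1 h1, zA4, q0, q1, q2, q4]; norm_num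
  · intro j; rw [L.rB j 1 h1, zB, q0, sb0, wB]; ring
  · intro k; rw [L.rC k 1 h1, zC, q0, q3, sc0, wC, hD0 k 1 h1]; ring
  · intro k; rw [L.rD k 1 h1, zD, q1, wC, hD0 k 1 h1]; ring
  · intro i'' b c
    rw [L.rE i'' b c 1 h1, zE, q0, q2, wB, wC, wC, hE0 i'' b c 1 h1, hF0 i'' b c 1 h1, Upsilon]
    simp only [cv0, cv1]; ring
  · intro i'' b c
    rw [L.rF i'' b c 1 h1, zF, q0, q2, q3, q4, wB, wC, wC, hE0 i'' b c 1 h1, hF0 i'' b c 1 h1,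
      Upsilon]
    simp only [cv0, cv1]; ring

theorem phase_two {m : ℕ} {M : CounterMachine m} {T : ℝ}
    {y z w : ℝ → Idx m → ℝ} (L : LocalSys M T y z w)
    (i : Fin m) (C₁ C₂ : ℕ)
    (H : z T (.A 0) = 0 ∧ z T (.A 1) = 0 ∧ z T (.A 2) = 1 ∧
      z T (.A 3) = 1 ∧ z T (.A 4) = 1 ∧
      (∀ j, z T (.B j) = 0) ∧
      (∀ k, z T (.C k) = cval C₁ C₂ k - 1 + indC (cval C₁ C₂ k = 0)) ∧
      (∀ k, z T (.D k) = indC (cval C₁ C₂ k = 0)) ∧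
      (∀ i'' b c, z T (.E i'' b c) = 3 + Upsilon i C₁ C₂ i'' b c) ∧
      (∀ i'' b c, z T (.F i'' b c) = 4 + Upsilon i C₁ C₂ i'' b c)) :
    z (T + 1) (.A 0) = 1 ∧ z (T + 1) (.A 1) = 0 ∧ z (T + 1) (.A 2) = 0 ∧
    z (T + 1) (.A 3) = 1 ∧ z (T + 1) (.A 4) = 1 ∧
    (∀ j, z (T + 1) (.B j) = 0) ∧
    (∀ k, z (T + 1) (.C k) = cval C₁ C₂ k) ∧
    (∀ k, z (T + 1) (.D k) = 0) ∧
    (∀ i'' b c, z (T + 1) (.E i'' b c) = 3 + Upsilon i C₁ C₂ i'' b c) ∧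
    (∀ i'' b c, z (T + 1) (.F i'' b c) = 4 + Upsilon i C₁ C₂ i'' b c) := by
  obtain ⟨zA0, zA1, zA2, zA3, zA4, zB, zC, zD, zE, zF⟩ := H
  have hA := A_cycle (L.comp (.A 1)) (L.comp (.A 2)) (L.comp (.A 3)) (L.comp (.A 4))
    (L.comp (.A 0))
    (by simpa [zA1] using L.a1) (by simpa [zA2] using L.a2) (by simpa [zA3] using L.a3)
    (by simpa [zA4] using L.a4) (by simpa [zA0] using L.a0)
  have nn := fun p => (L.comp p).1
  have hB0 : ∀ j, ∀ s ∈ Set.Icc (0:ℝ) 1, w s (.B j) = 0 := by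
    intro j
    refine (L.comp (.B j)).2.2.1 (fun s hs h0 => ?_)
    obtain ⟨q1, q2, q3, q4, q0⟩ := hA s hs
    have e := L.rB j s hs
    have := L.sb j s hs
    rw [zB, q0] at e
    linarith
  have hC0 : ∀ k, ((cval C₁ C₂ k : ℝ) = 0 ∧ indC (cval C₁ C₂ k = 0) = 1) ∨
      ((1:ℝ) ≤ cval C₁ C₂ k ∧ indC (cval C₁ C₂ k = 0) = 0) := by
    intro k
    rcases Nat.eq_zero_or_pos (cval C₁ C₂ k) with hk | hk
    · left; simp [indC, hk]
    · right
      refine ⟨by exact_mod_cast hk, ?_⟩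
      simp [indC, Nat.pos_iff_ne_zero.mp hk]
  have hCz : ∀ k, ∀ s ∈ Set.Icc (0:ℝ) 1, w s (.C k) = 0 := by
    intro k
    refine (L.comp (.C k)).2.2.1 (fun s hs h0 => ?_)
    obtain ⟨q1, q2, q3, q4, q0⟩ := hA s hs
    have e := L.rC k s hs
    have := L.sc k s hs
    have := nn (.D k) s hs
    rw [zC, q0, q3] at e
    rcases hC0 k with ⟨hk, hj⟩ | ⟨hk, hj⟩ <;> rw [hj] at e <;> linarith
  have hE0 : ∀ i'' b c, ∀ s ∈ Set.Icc (0:ℝ) 1, w s (.E i'' b c) = 0 := by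
    intro i'' b c
    refine (L.comp (.E i'' b c)).2.2.1 (fun s hs h0 => ?_)
    obtain ⟨q1, q2, q3, q4, q0⟩ := hA s hs
    have e := L.rE i'' b c s hs
    have := nn (.F i'' b c) s hs
    rw [zE, q0, q2, hB0 _ s hs, hCz _ s hs, hCz _ s hs] at e
    linarith [(ups_bounds i C₁ C₂ i'' b c).1]
  have hF0 : ∀ i'' b c, ∀ s ∈ Set.Icc (0:ℝ) 1, w s (.F i'' b c) = 0 := by
    intro i'' b c
    refine (L.comp (.F i'' b c)).2.2.1 (fun s hs h0 => ?_)
    obtain ⟨q1, q2, q3, q4, q0⟩ := hA s hs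
    have e := L.rF i'' b c s hs
    have := nn (.E i'' b c) s hs
    rw [zF, q0, q2, q3, q4, hB0 _ s hs, hCz _ s hs, hCz _ s hs] at e
    linarith [(ups_bounds i C₁ C₂ i'' b c).1]
  have h1 : (1:ℝ) ∈ Set.Icc (0:ℝ) 1 := by simp
  have wD : ∀ k, w 1 (.D k) = 1 - indC (cval C₁ C₂ k = 0) := by
    intro k
    have e1 := L.rD k 1 h1
    have p1 := (L.comp (.D k)).2.1 1 h1
    rw [zD, (hA 1 h1).1, hCz _ 1 h1] at e1
    rcases hC0 k with ⟨hk, hj⟩ | ⟨hk, hj⟩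
    · have := (L.comp (.D k)).2.2.1 (fun s hs h0 => by
        have e := L.rD k s hs
        rw [zD, (hA s hs).1, hCz _ s hs, hj] at e
        linarith [hs.2]) 1 h1
      simp only at this
      rw [this, hj]; ring
    · have := (L.comp (.D k)).2.2.2 (fun s hs h0 => by
        have e := L.rD k s hs
        rw [zD, (hA s hs).1, hCz _ s hs, hj] at e
        linarith [hs.2]) 1 h1
      simp only at this
      rw [hj] at e1 ⊢
      linarith
  obtain ⟨q1, q2, q3, q4, q0⟩ := hA 1 h1
  have sb0 : ∀ j, SB M (w 1) j = 0 := fun j => SB_zero M _ j (fun i b c => hE0 i b c 1 h1)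
  have sc0 : ∀ j, SC M (w 1) j = 0 := fun j => SC_zero M _ j (fun i b c => hE0 i b c 1 h1)
  refine ⟨?_, ?_, ?_, ?_, ?_, ?_, ?_, ?_, ?_, ?_⟩
  · rw [L.a0 1 h1, zA0, q0, q1, q2, q3]; norm_num
  · rw [L.a1 1 h1, zA1, q1, q2, q3, q4]; norm_num
  · rw [L.a2 1 h1, zA2, q0, q2, q3, q4]; norm_num
  · rw [L.a3 1 h1, zA3, q0, q1, q3, q4]; norm_num
  · rw [L.a4 1 h1, zA4, q0, q1, q2, q4]; norm_num
  · intro j; rw [L.rB j 1 h1, zB, q0, sb0, hB0 j 1 h1]; ring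
  · intro k; rw [L.rC k 1 h1, zC, q0, q3, sc0, hCz k 1 h1, wD]; ring
  · intro k; rw [L.rD k 1 h1, zD, q1, hCz k 1 h1, wD]; ring
  · intro i'' b c
    rw [L.rE i'' b c 1 h1, zE, q0, q2, hB0 _ 1 h1, hCz _ 1 h1, hCz _ 1 h1, hE0 i'' b c 1 h1,
      hF0 i'' b c 1 h1]
    ring
  · intro i'' b c
    rw [L.rF i'' b c 1 h1, zF, q0, q2, q3, q4, hB0 _ 1 h1, hCz _ 1 h1, hCz _ 1 h1,
      hE0 i'' b c 1 h1, hF0 i'' b c 1 h1]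
    ring

/-- Dynamics over the interval `(5t+2, 5t+3)`: `y_{A,3}` and
`y_{E,(i,b*,c*)}` (with `b* = min(C₁,1)`, `c* = min(C₂,1)`) are active at unit
rate, all remaining `y`-coordinates are passive, and the state `z(5t+3)` is as
indicated. -/
theorem dynamics_interval_2 {m : ℕ} (M : CounterMachine m)
    (i0 : Fin m) (C₁0 C₂0 : ℕ) (y z : ℝ → Idx m → ℝ)
    (h : IsSkorokhodSolution (Rmat M) (fluidX i0 C₁0 C₂0) y z)
    (t : ℕ) (i : Fin m) (C₁ C₂ : ℕ)
    (htraj : (M.step)^[t] (i0, C₁0, C₂0) = (i, C₁, C₂))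
    (hz : z (5 * (t : ℝ)) = encCfg i C₁ C₂)
    (bstar cstar : Bool) (hb : bstar = decide (0 < C₁)) (hc : cstar = decide (0 < C₂))
    (i' : Fin m) (Δ₁ Δ₂ : ℤ) (hΓ : M.Γ i bstar cstar = (i', Δ₁, Δ₂)) :
    (UnitActive (fun s => y s (.A 2)) (5 * (t : ℝ) + 2) (5 * (t : ℝ) + 3)) ∧
    (UnitActive (fun s => y s (.E i bstar cstar)) (5 * (t : ℝ) + 2) (5 * (t : ℝ) + 3)) ∧
    (∀ k : Fin 5, k ≠ 2 →
      Passive (fun s => y s (.A k)) (5 * (t : ℝ) + 2) (5 * (t : ℝ) + 3)) ∧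
    (∀ j : Fin m, Passive (fun s => y s (.B j)) (5 * (t : ℝ) + 2) (5 * (t : ℝ) + 3)) ∧
    (∀ k : Fin 2, Passive (fun s => y s (.C k)) (5 * (t : ℝ) + 2) (5 * (t : ℝ) + 3)) ∧
    (∀ k : Fin 2, Passive (fun s => y s (.D k)) (5 * (t : ℝ) + 2) (5 * (t : ℝ) + 3)) ∧
    (∀ (i'' : Fin m) (b c : Bool), (i'', b, c) ≠ (i, bstar, cstar) →
      Passive (fun s => y s (.E i'' b c)) (5 * (t : ℝ) + 2) (5 * (t : ℝ) + 3)) ∧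
    (∀ (i'' : Fin m) (b c : Bool),
      Passive (fun s => y s (.F i'' b c)) (5 * (t : ℝ) + 2) (5 * (t : ℝ) + 3)) ∧
    (z (5 * (t : ℝ) + 3) (.A 0) = 1 ∧ z (5 * (t : ℝ) + 3) (.A 1) = 1 ∧
      z (5 * (t : ℝ) + 3) (.A 2) = 0 ∧ z (5 * (t : ℝ) + 3) (.A 3) = 0 ∧
      z (5 * (t : ℝ) + 3) (.A 4) = 1) ∧
    (z (5 * (t : ℝ) + 3) (.B i') = 0) ∧
    (∀ j : Fin m, j ≠ i' → z (5 * (t : ℝ) + 3) (.B j) = 1) ∧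
    (z (5 * (t : ℝ) + 3) (.C 0) = (C₁ : ℝ) + (Δ₁ : ℝ) + 1) ∧
    (z (5 * (t : ℝ) + 3) (.C 1) = (C₂ : ℝ) + (Δ₂ : ℝ) + 1) ∧
    (∀ k : Fin 2, z (5 * (t : ℝ) + 3) (.D k) = 0) ∧
    (∀ (i'' : Fin m) (b c : Bool),
      z (5 * (t : ℝ) + 3) (.E i'' b c) =
        2 + Upsilon i C₁ C₂ i'' b c + indC ((i'', b, c) = (i, bstar, cstar))) ∧
    (∀ (i'' : Fin m) (b c : Bool),
      z (5 * (t : ℝ) + 3) (.F i'' b c) =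
        3 + Upsilon i C₁ C₂ i'' b c + indC ((i'', b, c) = (i, bstar, cstar))) := by
  have hT : (0:ℝ) ≤ 5 * (t : ℝ) := by positivity
  obtain ⟨w₁, L₁⟩ := exists_localSys h (5 * (t : ℝ)) hT
  have P₁ := phase_one L₁ i C₁ C₂ hz
  obtain ⟨w₂, L₂⟩ := exists_localSys h (5 * (t : ℝ) + 1) (by linarith)
  have P₂ := phase_two L₂ i C₁ C₂ P₁
  have hT2 : 5 * (t : ℝ) + 1 + 1 = 5 * (t : ℝ) + 2 := by ring
  rw [hT2] at P₂
  obtain ⟨w, L⟩ := exists_localSys h (5 * (t : ℝ) + 2) (by linarith)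
  have hT3 : 5 * (t : ℝ) + 3 = 5 * (t : ℝ) + 2 + 1 := by ring
  rw [hT3]
  generalize 5 * (t : ℝ) + 2 = T at *
  obtain ⟨zA0, zA1, zA2, zA3, zA4, zB, zC, zD, zE, zF⟩ := P₂
  have hA := A_cycle (L.comp (.A 2)) (L.comp (.A 3)) (L.comp (.A 4)) (L.comp (.A 0))
    (L.comp (.A 1))
    (by simpa [zA2] using L.a2) (by simpa [zA3] using L.a3) (by simpa [zA4] using L.a4)
    (by simpa [zA0] using L.a0) (by simpa [zA1] using L.a1)
  have nn := fun p => (L.comp p).1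
  have hB0 : ∀ j, ∀ s ∈ Set.Icc (0:ℝ) 1, w s (.B j) = 0 := by
    intro j
    refine (L.comp (.B j)).2.2.1 (fun s hs h0 => ?_)
    obtain ⟨q2, q3, q4, q0, q1⟩ := hA s hs
    have e := L.rB j s hs
    have := L.sb j s hs
    rw [zB, q0] at e
    linarith
  have hCz : ∀ k, ∀ s ∈ Set.Icc (0:ℝ) 1, w s (.C k) = 0 := by
    intro k
    refine (L.comp (.C k)).2.2.1 (fun s hs h0 => ?_)
    obtain ⟨q2, q3, q4, q0, q1⟩ := hA s hs
    have e := L.rC k s hs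
    have := L.sc k s hs
    have := nn (.D k) s hs
    have : (0:ℝ) ≤ cval C₁ C₂ k := Nat.cast_nonneg _
    rw [zC, q0, q3] at e
    linarith
  have hDz : ∀ k, ∀ s ∈ Set.Icc (0:ℝ) 1, w s (.D k) = 0 := by
    intro k
    refine (L.comp (.D k)).2.2.1 (fun s hs h0 => ?_)
    obtain ⟨q2, q3, q4, q0, q1⟩ := hA s hs
    have e := L.rD k s hs
    have := nn (.C k) s hs
    rw [zD, q1] at e
    linarith
  have hF0 : ∀ i'' b c, ∀ s ∈ Set.Icc (0:ℝ) 1, w s (.F i'' b c) = 0 := by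
    intro i'' b c
    refine (L.comp (.F i'' b c)).2.2.1 (fun s hs h0 => ?_)
    obtain ⟨q2, q3, q4, q0, q1⟩ := hA s hs
    have e := L.rF i'' b c s hs
    have := nn (.E i'' b c) s hs
    rw [zF, q0, q2, q3, q4, hB0 _ s hs, hCz _ s hs, hCz _ s hs] at e
    linarith [(ups_bounds i C₁ C₂ i'' b c).1, hs.2]
  have hE0 : ∀ i'' b c, (i'', b, c) ≠ (i, bstar, cstar) →
      ∀ s ∈ Set.Icc (0:ℝ) 1, w s (.E i'' b c) = 0 := by
    intro i'' b c hne
    rw [hb, hc] at hne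
    refine (L.comp (.E i'' b c)).2.2.1 (fun s hs h0 => ?_)
    obtain ⟨q2, q3, q4, q0, q1⟩ := hA s hs
    have e := L.rE i'' b c s hs
    have := nn (.F i'' b c) s hs
    rw [zE, q0, q2, hB0 _ s hs, hCz _ s hs, hCz _ s hs] at e
    linarith [(ups_bounds i C₁ C₂ i'' b c).2.1 hne, hs.2]
  have hEs : ∀ s ∈ Set.Icc (0:ℝ) 1, w s (.E i bstar cstar) = s := by
    have hU : Upsilon i C₁ C₂ i bstar cstar = -3 :=
      (ups_bounds i C₁ C₂ i bstar cstar).2.2 (by rw [hb, hc])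
    have key : ∀ s ∈ Set.Icc (0:ℝ) 1,
        z (T + s) (.E i bstar cstar) = w s (.E i bstar cstar) - s := by
      intro s hs
      obtain ⟨q2, q3, q4, q0, q1⟩ := hA s hs
      rw [L.rE i bstar cstar s hs, zE, hU, q0, q2, hB0 _ s hs, hCz _ s hs, hCz _ s hs,
        hF0 _ _ _ s hs]
      ring
    have up := (L.comp (.E i bstar cstar)).2.2.2 (fun s hs h0 => by
      have := key s hs
      linarith)
    intro s hs
    refine le_antisymm (up s hs) ?_
    have p := (L.comp (.E i bstar cstar)).2.1 s hs
    have := key s hs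
    linarith
  have hEind : ∀ i'' b c, ∀ s ∈ Set.Icc (0:ℝ) 1,
      w s (.E i'' b c) = indC ((i'', b, c) = (i, bstar, cstar)) * s := by
    intro i'' b c s hs
    by_cases he : (i'', b, c) = (i, bstar, cstar)
    · have he' := he
      simp only [Prod.mk.injEq] at he'
      obtain ⟨rfl, rfl, rfl⟩ := he'
      rw [hEs s hs]; simp [indC]
    · rw [hE0 _ _ _ he s hs]; simp [indC, he]
  -- conversion to activity statements
  have act : ∀ p, (∀ s ∈ Set.Icc (0:ℝ) 1, w s p = s) → UnitActive (fun s => y s p) T (T + 1) := by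
    intro p hp s hs
    have e := L.inc (s - T) p
    rw [hp (s - T) ⟨by linarith [hs.1], by linarith [hs.2]⟩, add_sub_cancel] at e
    simp only [e]
    ring
  have pas : ∀ p, (∀ s ∈ Set.Icc (0:ℝ) 1, w s p = 0) → Passive (fun s => y s p) T (T + 1) := by
    intro p hp s hs
    have e := L.inc (s - T) p
    rw [hp (s - T) ⟨by linarith [hs.1], by linarith [hs.2]⟩, add_sub_cancel, add_zero] at e
    exact e
  have h1 : (1:ℝ) ∈ Set.Icc (0:ℝ) 1 := by simp
  obtain ⟨q2, q3, q4, q0, q1⟩ := hA 1 h1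
  have sumE : ∀ g : Fin m → Bool → Bool → ℝ, ∑ e : Fin m × Bool × Bool,
      g e.1 e.2.1 e.2.2 * w 1 (.E e.1 e.2.1 e.2.2) = g i bstar cstar := by
    intro g
    rw [Finset.sum_eq_single (i, bstar, cstar)]
    · simp only [hEs 1 h1, mul_one]
    · rintro ⟨i1, b1, c1⟩ - hne
      rw [hE0 i1 b1 c1 hne 1 h1, mul_zero]
    · simp
  have sb1 : ∀ j, SB M (w 1) j = if i' = j then 0 else 1 := by
    intro j
    have := sumE (fun i b c => if (M.Γ i b c).1 = j then 0 else 1)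
    simp only [hΓ] at this
    exact this
  have sc1 : ∀ k : Fin 2, SC M (w 1) k = (if k = 0 then (Δ₁ : ℝ) else (Δ₂ : ℝ)) + 1 := by
    intro k
    have := sumE (fun i b c =>
      (if k = 0 then ((M.Γ i b c).2.1 : ℝ) else ((M.Γ i b c).2.2 : ℝ)) + 1)
    simp only [hΓ] at this
    exact this
  refine ⟨act _ fun s hs => (hA s hs).1, act _ hEs, ?_, fun j => pas _ (hB0 j),
    fun k => pas _ (hCz k), fun k => pas _ (hDz k), fun i'' b c hne => pas _ (hE0 i'' b c hne),
    fun i'' b c => pas _ (hF0 i'' b c), ⟨?_, ?_, ?_, ?_, ?_⟩, ?_, ?_, ?_, ?_, ?_, ?_, ?_⟩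
  · intro k hk
    apply pas
    intro s hs
    obtain ⟨r2, r3, r4, r0, r1⟩ := hA s hs
    fin_cases k
    · exact r0
    · exact r1
    · exact absurd rfl hk
    · exact r3
    · exact r4
  · rw [L.a0 1 h1, zA0, q0, q1, q2, q3]; norm_num
  · rw [L.a1 1 h1, zA1, q1, q2, q3, q4]; norm_num
  · rw [L.a2 1 h1, zA2, q0, q2, q3, q4]; norm_num
  · rw [L.a3 1 h1, zA3, q0, q1, q3, q4]; norm_num
  · rw [L.a4 1 h1, zA4, q0, q1, q2, q4]; norm_num
  · rw [L.rB i' 1 h1, zB, q0, sb1, hB0 _ 1 h1, if_pos rfl]; ring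
  · intro j hj
    rw [L.rB j 1 h1, zB, q0, sb1, hB0 _ 1 h1, if_neg (Ne.symm hj)]; ring
  · rw [L.rC 0 1 h1, zC, q0, q3, sc1, hCz _ 1 h1, hDz _ 1 h1]
    simp only [cval, if_true]; ring
  · rw [L.rC 1 1 h1, zC, q0, q3, sc1, hCz _ 1 h1, hDz _ 1 h1]
    simp only [cval, one_ne_zero, if_false]; ring
  · intro k; rw [L.rD k 1 h1, zD, q1, hCz k 1 h1, hDz k 1 h1]; ring
  · intro i'' b c
    rw [L.rE i'' b c 1 h1, zE, q0, q2, hB0 _ 1 h1, hCz _ 1 h1, hCz _ 1 h1, hEind i'' b c 1 h1,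
      hF0 i'' b c 1 h1]
    ring
  · intro i'' b c
    rw [L.rF i'' b c 1 h1, zF, q0, q2, q3, q4, hB0 _ 1 h1, hCz _ 1 h1, hCz _ 1 h1,
      hEind i'' b c 1 h1, hF0 i'' b c 1 h1]
    ring
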